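/- Let P be a set of n points in ℝ² whose pairwise distances are all distinct. Then γ_b(P) ≤ 5n/6, where γ_b(P) is the broadcast domination number of P. -/

import Mathlib

variable {E : Type*} [MetricSpace E]

/-- All pairwise distances between points of `P` are distinct: two pairs of distinct
points at equal distance must be the same (unordered) pair. -/
def DistinctDistances (P : Finset E) : Prop :=
  ∀ p ∈ P, ∀ q ∈ P, ∀ r ∈ P, ∀ s ∈ P, p ≠ q → r ≠ s →
    dist p q = dist r s → ({p, q} : Set E) = {r, s}

/-- `nbhd P v r` is `N_r[v]`: the set consisting of `v` together with the `r`
points of `P` nearest to `v`. A point `u ∈ P` belongs to it iff at most `r + 1`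
points of `P` (including `v` itself) are at distance at most `dist v u` from `v`. -/
def nbhd (P : Finset E) (v : E) (r : ℕ) : Set E :=
  {u | u ∈ P ∧ ({b | b ∈ P ∧ dist v b ≤ dist v u}).ncard ≤ r + 1}

/-- A multipacking of a point set `P`: a subset `M ⊆ P` with
`|N_r[v] ∩ M| ≤ (r+1)/2` for all `v ∈ P` and all integers `r ≥ 1`. -/
def IsGeoMultipacking (P : Finset E) (M : Set E) : Prop :=
  M ⊆ ↑P ∧ ∀ v ∈ P, ∀ r : ℕ, 1 ≤ r →
    ((nbhd P v r ∩ M).ncard : ℚ) ≤ ((r : ℚ) + 1) / 2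

/-- The multipacking number of a point set `P`: the maximum size of a multipacking. -/
noncomputable def geoMultipackingNumber (P : Finset E) : ℕ :=
  sSup {m | ∃ M : Set E, IsGeoMultipacking P M ∧ M.ncard = m}

/-- A dominating broadcast on a point set `P`: a function `f : P → {0, …, n−1}`
(extended by `0` off `P`) such that every `u ∈ P` lies in `N_{f v}[v]` for some
`v ∈ P` with `f v > 0`. -/
def IsGeoDominatingBroadcast (P : Finset E) (f : E → ℕ) : Prop :=
  (∀ v : E, v ∉ P → f v = 0) ∧ (∀ v ∈ P, f v ≤ P.card - 1) ∧
    ∀ u ∈ P, ∃ v ∈ P, 0 < f v ∧ u ∈ nbhd P v (f v)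

/-- The broadcast domination number of a point set `P`: the minimum cost of a
dominating broadcast on `P`. -/
noncomputable def geoBroadcastDominationNumber (P : Finset E) : ℕ :=
  sInf {c | ∃ f : E → ℕ, IsGeoDominatingBroadcast P f ∧ ∑ v ∈ P, f v = c}

/-- Two complex numbers lying at distance greater than both of their norms are seen from
the origin under an angle greater than `π / 3`. -/
lemma pi_div_three_lt_abs_arg_sub_arg {a b : ℂ} (ha : ‖a‖ < ‖a - b‖) (hb : ‖b‖ < ‖a - b‖) :
    Real.pi / 3 < |a.arg - b.arg| := by
  by_contra! h
  have hcos : 1 / 2 ≤ Real.cos (a.arg - b.arg) := by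
    rw [← Real.cos_abs, ← Real.cos_pi_div_three]
    exact Real.cos_le_cos_of_nonneg_of_le_pi (abs_nonneg _) (by linarith [Real.pi_pos]) h
  have hinner : ‖a‖ * ‖b‖ * Real.cos (a.arg - b.arg) = a.re * b.re + a.im * b.im := by
    rw [Real.cos_sub, ← Complex.norm_mul_cos_arg a, ← Complex.norm_mul_cos_arg b,
      ← Complex.norm_mul_sin_arg a, ← Complex.norm_mul_sin_arg b]
    ring
  have hsq : ‖a - b‖ ^ 2 = ‖a‖ ^ 2 + ‖b‖ ^ 2 - 2 * (a.re * b.re + a.im * b.im) := by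
    simp only [Complex.sq_norm, Complex.normSq_apply, Complex.sub_re, Complex.sub_im]
    ring
  have hle : ‖a - b‖ ^ 2 ≤ ‖a‖ ^ 2 + ‖b‖ ^ 2 - ‖a‖ * ‖b‖ := by
    have := mul_le_mul_of_nonneg_left hcos (mul_nonneg (norm_nonneg a) (norm_nonneg b))
    linarith
  rcases le_total ‖a‖ ‖b‖ with hab | hab <;>
    nlinarith [norm_nonneg a, norm_nonneg b, norm_nonneg (a - b)]

/-- The index of the sector of width `π / 3` containing the angle `x`, for angles in
`[-π, π]` of absolute value at least `π / 3`. -/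
noncomputable def angularSector (x : ℝ) : Fin 4 :=
  if x < 0 then if x < -(2 * Real.pi / 3) then 0 else 1
  else if x < 2 * Real.pi / 3 then 2 else 3

lemma abs_sub_le_of_angularSector_eq {x y : ℝ} (hx : |x| ≤ Real.pi) (hy : |y| ≤ Real.pi)
    (hx' : Real.pi / 3 ≤ |x|) (hy' : Real.pi / 3 ≤ |y|)
    (h : angularSector x = angularSector y) : |x - y| ≤ Real.pi / 3 := by
  rw [abs_le] at hx hy ⊢
  unfold angularSector at h
  rcases lt_or_ge x 0 with hx0 | hx0 <;> rcases lt_or_ge y 0 with hy0 | hy0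
  · rw [abs_of_neg hx0] at hx'
    rw [abs_of_neg hy0] at hy'
    rw [if_pos hx0, if_pos hy0] at h
    split_ifs at h <;> first | simp at h; done | constructor <;> linarith
  · rw [if_pos hx0, if_neg hy0.not_gt] at h
    split_ifs at h <;> simp at h
  · rw [if_neg hx0.not_gt, if_pos hy0] at h
    split_ifs at h <;> simp at h
  · rw [abs_of_nonneg hx0] at hx'
    rw [abs_of_nonneg hy0] at hy'
    rw [if_neg hx0.not_gt, if_neg hy0.not_gt] at h
    split_ifs at h <;> first | simp at h; done | constructor <;> linarith

/-- A finite set of complex numbers, any two of which are at distance greater than both of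
their norms, has at most five elements. -/
lemma card_le_five_of_norm_lt_norm_sub (T : Finset ℂ)
    (hT : ∀ a ∈ T, ∀ b ∈ T, a ≠ b → ‖a‖ < ‖a - b‖) : T.card ≤ 5 := by
  by_contra! hcard
  obtain ⟨a, haT, b, hbT, hab⟩ := Finset.one_lt_card.mp (show 1 < T.card by omega)
  have ha : a ≠ 0 := by
    rintro rfl
    simpa using hT b hbT 0 haT hab.symm
  have hdiv : ∀ b ∈ T, ∀ c ∈ T, b ≠ c → Real.pi / 3 < |(b / a).arg - (c / a).arg| := by
    have key : ∀ b ∈ T, ∀ c ∈ T, b ≠ c → ‖b / a‖ < ‖b / a - c / a‖ := fun b hb c hc hbc => by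
      rw [← sub_div, norm_div, norm_div]
      exact div_lt_div_of_pos_right (hT b hb c hc hbc) (norm_pos_iff.mpr ha)
    intro b hb c hc hbc
    refine pi_div_three_lt_abs_arg_sub_arg (key b hb c hc hbc) ?_
    rw [norm_sub_rev]
    exact key c hc b hb hbc.symm
  obtain ⟨b, hb, c, hc, hbc, hsector⟩ :=
    Finset.exists_ne_map_eq_of_card_lt_of_maps_to (s := T.erase a) (t := Finset.univ)
      (f := fun b => angularSector (b / a).arg) (by rw [Finset.card_erase_of_mem haT]; simp; omega)
      (fun _ _ => by simp)
  obtain ⟨hba, hbT⟩ := Finset.mem_erase.mp hb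
  obtain ⟨hca, hcT⟩ := Finset.mem_erase.mp hc
  have hb0 := hdiv b hbT a haT hba
  have hc0 := hdiv c hcT a haT hca
  have hdist := hdiv b hbT c hcT hbc
  simp only [div_self ha, Complex.arg_one, sub_zero] at hb0 hc0
  exact absurd hdist (not_lt.mpr (abs_sub_le_of_angularSector_eq (Complex.abs_arg_le_pi _)
    (Complex.abs_arg_le_pi _) hb0.le hc0.le hsector))

/-- At most five points of the Euclidean plane can be placed around `w` so that any two of
them are at distance greater than both of their distances to `w`. -/
lemma card_le_five_of_dist_lt_dist (w : EuclideanSpace ℝ (Fin 2))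
    (T : Finset (EuclideanSpace ℝ (Fin 2)))
    (hT : ∀ a ∈ T, ∀ b ∈ T, a ≠ b → dist a w < dist a b) : T.card ≤ 5 := by
  classical
  let e := Complex.orthonormalBasisOneI.repr.symm
  have hinj : Function.Injective fun u => e (u - w) :=
    e.injective.comp sub_left_injective
  rw [← Finset.card_image_of_injective T hinj]
  refine card_le_five_of_norm_lt_norm_sub _ fun a ha b hb hab => ?_
  obtain ⟨u, hu, rfl⟩ := Finset.mem_image.mp ha
  obtain ⟨v, hv, rfl⟩ := Finset.mem_image.mp hb
  have huv : u ≠ v := fun h => hab (by rw [h])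
  rw [← map_sub, e.norm_map, e.norm_map, sub_sub_sub_cancel_right,
    ← dist_eq_norm, ← dist_eq_norm]
  exact hT u hu v hv huv

/-- If `N` is a fixed-point-free self-map of `P` whose functional graph has maximum degree at
most `d`, then `P` is covered by at most `d * |P| / (d + 1)` edges `{v, N v}`. -/
lemma exists_cover_card_le {α : Type*} [DecidableEq α] (P : Finset α) (N : α → α) (d : ℕ)
    (hmem : ∀ v ∈ P, N v ∈ P) (hne : ∀ v ∈ P, N v ≠ v)
    (hdeg : ∀ w ∈ P, (insert (N w) (P.filter fun u => N u = w)).card ≤ d) :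
    ∃ S ⊆ P, (∀ u ∈ P, u ∈ S ∨ ∃ v ∈ S, N v = u) ∧ (d + 1) * S.card ≤ d * P.card := by
  obtain ⟨S, hS, hmin⟩ := Finset.exists_min_image
    (P.powerset.filter fun S => ∀ u ∈ P, u ∈ S ∨ ∃ v ∈ S, N v = u) Finset.card
    ⟨P, by simp +contextual⟩
  obtain ⟨hSP, hcov⟩ := Finset.mem_filter.mp hS
  rw [Finset.mem_powerset] at hSP
  have hcenter : ∀ v ∈ S, (∃ u ∈ S, N u = v) → N v ∉ S ∧ ∀ u ∈ S, N u = N v → u = v := by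
    rintro v hv ⟨v', hv', rfl⟩
    by_contra hcon
    have hcov' : ∀ u ∈ P, u ∈ S.erase (N v') ∨ ∃ s ∈ S.erase (N v'), N s = u := by
      have hv'ne := hne v' (hSP hv')
      have hvne := hne _ (hSP hv)
      intro u hu
      simp only [Finset.mem_erase]
      grind
    have := hmin (S.erase (N v'))
      (Finset.mem_filter.mpr
        ⟨Finset.mem_powerset.mpr ((Finset.erase_subset _ _).trans hSP), hcov'⟩)
    exact absurd (Finset.card_erase_lt_of_mem hv) (not_lt.mpr this)
  refine ⟨S, hSP, hcov, ?_⟩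
  let g : α → α := fun v => if N v ∈ S then N (N v) else N v
  have hg : ∀ v ∈ S, g v ∈ P \ S := by
    intro v hv
    have hvP := hSP hv
    simp only [g]
    split_ifs with h
    · exact Finset.mem_sdiff.mpr ⟨hmem _ (hmem v hvP), (hcenter _ h ⟨v, hv, rfl⟩).1⟩
    · exact Finset.mem_sdiff.mpr ⟨hmem v hvP, h⟩
  have hfiber : ∀ x ∈ P \ S, (S.filter fun v => g v = x).card ≤ d := by
    intro x hx
    obtain ⟨hxP, hxS⟩ := Finset.mem_sdiff.mp hx
    by_cases h : ∃ v ∈ S, N v ∈ S ∧ N (N v) = x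
    · obtain ⟨v, hv, hw, rfl⟩ := h
      have huniq := (hcenter _ hw ⟨v, hv, rfl⟩).2
      have hsub : (S.filter fun u => g u = N (N v)) ⊆
          insert (N v) (S.filter fun u => N u = N v) := by
        intro u hu
        simp only [Finset.mem_filter, Finset.mem_insert, g] at hu ⊢
        obtain ⟨huS, hgu⟩ := hu
        split_ifs at hgu with hNu
        · exact Or.inr ⟨huS, huniq _ hNu hgu⟩
        · exact Or.inl (huniq _ huS hgu)
      calc _ ≤ (insert (N v) (S.filter fun u => N u = N v)).card := Finset.card_le_card hsub
        _ ≤ (S.filter fun u => N u = N v).card + 1 := Finset.card_insert_le _ _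
        _ = (insert (N (N v)) (S.filter fun u => N u = N v)).card :=
            (Finset.card_insert_of_notMem fun hm => hxS (Finset.mem_filter.mp hm).1).symm
        _ ≤ (insert (N (N v)) (P.filter fun u => N u = N v)).card :=
            Finset.card_le_card
              (Finset.insert_subset_insert _ (Finset.filter_subset_filter _ hSP))
        _ ≤ d := hdeg _ (hSP hw)
    · push Not at h
      refine (Finset.card_le_card fun u hu => ?_).trans (hdeg x hxP)
      simp only [Finset.mem_filter, g] at hu
      obtain ⟨huS, hgu⟩ := hu
      split_ifs at hgu with hNu
      · exact absurd hgu (h u huS hNu)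
      · exact Finset.mem_insert_of_mem (Finset.mem_filter.mpr ⟨hSP huS, hgu⟩)
  have hcard := Finset.card_le_mul_card_image_of_maps_to hg d hfiber
  have hsdiff := Finset.card_sdiff_add_card_eq_card hSP
  rw [← hsdiff]
  linarith

/-- In a set with distinct distances, every point has a unique nearest neighbor. -/
lemma DistinctDistances.exists_nearest {P : Finset E} (hdist : DistinctDistances P)
    (hcard : 1 < P.card) {v : E} (hv : v ∈ P) :
    ∃ u ∈ P, u ≠ v ∧ ∀ b ∈ P, b ≠ v → b ≠ u → dist v u < dist v b := by
  classical
  obtain ⟨u, hu, hmin⟩ := Finset.exists_min_image (P.erase v) (dist v)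
    ((Finset.one_lt_card_iff_nontrivial.mp hcard).erase_nonempty)
  obtain ⟨huv, huP⟩ := Finset.mem_erase.mp hu
  refine ⟨u, huP, huv, fun b hb hbv hbu => ?_⟩
  refine (hmin b (Finset.mem_erase.mpr ⟨hbv, hb⟩)).lt_of_ne fun heq => ?_
  have hpair := hdist v hv u huP v hv b hb huv.symm hbv.symm heq
  have : b ∈ ({v, u} : Set E) := hpair ▸ Set.mem_insert_of_mem v rfl
  rcases this with h | h
  · exact hbv h
  · exact hbu h

/-- A set `S` of points that, together with their nearest neighbors, exhaust `P` bounds the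
broadcast domination number of `P`. -/
lemma geoBroadcastDominationNumber_le_card {P S : Finset E} {N : E → E} (hcard : 1 < P.card)
    (hN : ∀ v ∈ P, N v ∈ P ∧ ∀ b ∈ P, b ≠ v → b ≠ N v → dist v (N v) < dist v b)
    (hSP : S ⊆ P) (hcov : ∀ u ∈ P, u ∈ S ∨ ∃ v ∈ S, N v = u) :
    geoBroadcastDominationNumber P ≤ S.card := by
  classical
  refine Nat.sInf_le ⟨fun v => if v ∈ S then 1 else 0, ⟨?_, ?_, ?_⟩, ?_⟩
  · exact fun v hv => if_neg fun h => hv (hSP h)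
  · intro v _
    dsimp only
    split_ifs <;> omega
  · intro u hu
    have hpos : ∃ v ∈ S, u ∈ nbhd P v 1 := by
      rcases hcov u hu with huS | ⟨v, hv, rfl⟩
      · refine ⟨u, huS, hu, (Set.ncard_le_ncard (t := {u}) ?_).trans (by simp)⟩
        rintro b ⟨_, hb⟩
        rw [dist_self] at hb
        exact (dist_le_zero.mp hb).symm
      · refine ⟨v, hv, hu, (Set.ncard_le_ncard (t := {v, N v}) ?_).trans
          (Set.ncard_insert_le _ _ |>.trans (by simp))⟩
        rintro b ⟨hbP, hb⟩
        by_contra hcon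
        simp only [Set.mem_insert_iff, Set.mem_singleton_iff, not_or] at hcon
        exact absurd ((hN v (hSP hv)).2 b hbP hcon.1 hcon.2) (not_lt.mpr hb)
    obtain ⟨v, hv, huv⟩ := hpos
    exact ⟨v, hSP hv, by simp [hv], by simpa [hv] using huv⟩
  · rw [Finset.sum_ite_mem, Finset.inter_eq_right.mpr hSP]
    simp

/-- For a set P of n points in ℝ² with pairwise distinct distances,
γ_b(P) ≤ 5n/6. -/
theorem stmt19 (n : ℕ) (P : Finset (EuclideanSpace ℝ (Fin 2))) (hcard : P.card = n)
    (hdist : DistinctDistances P) :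
    (geoBroadcastDominationNumber P : ℚ) ≤ 5 * n / 6 := by
  classical
  rcases lt_or_ge 1 P.card with hlt | hle
  · have hex : ∀ v, ∃ u, v ∈ P →
        u ∈ P ∧ u ≠ v ∧ ∀ b ∈ P, b ≠ v → b ≠ u → dist v u < dist v b := fun v => by
      by_cases hv : v ∈ P
      · obtain ⟨u, hu⟩ := hdist.exists_nearest hlt hv
        exact ⟨u, fun _ => hu⟩
      · exact ⟨v, fun h => absurd h hv⟩
    choose N hN using hex
    have hdeg : ∀ w ∈ P, (insert (N w) (P.filter fun u => N u = w)).card ≤ 5 := by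
      refine fun w hw => card_le_five_of_dist_lt_dist w _ fun a ha b hb hab => ?_
      obtain ⟨hNwP, hNww, hNw⟩ := hN w hw
      have hin : ∀ u ∈ P, N u = w → u ≠ w ∧ ∀ c ∈ P, c ≠ u → c ≠ w → dist u w < dist u c := by
        rintro u hu rfl
        exact ⟨(hN u hu).2.1.symm, (hN u hu).2.2⟩
      simp only [Finset.mem_insert, Finset.mem_filter] at ha hb
      rcases ha with rfl | ⟨haP, ha⟩
      · rcases hb with rfl | ⟨hbP, hb⟩
        · exact absurd rfl hab
        · obtain ⟨hbw, hmin⟩ := hin b hbP hb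
          calc dist (N w) w = dist w (N w) := dist_comm _ _
            _ < dist w b := hNw b hbP hbw hab.symm
            _ = dist b w := dist_comm _ _
            _ < dist b (N w) := hmin _ hNwP hab hNww
            _ = dist (N w) b := dist_comm _ _
      · rcases hb with rfl | ⟨hbP, hb⟩
        · exact (hin a haP ha).2 _ hNwP hab.symm hNww
        · exact (hin a haP ha).2 b hbP hab.symm (hin b hbP hb).1
    obtain ⟨S, hSP, hcov, hS⟩ := exists_cover_card_le P N 5 (fun v hv => (hN v hv).1)
      (fun v hv => (hN v hv).2.1) hdeg
    have hle := geoBroadcastDominationNumber_le_card hlt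
      (fun v hv => ⟨(hN v hv).1, (hN v hv).2.2⟩) hSP hcov
    rw [hcard] at hS
    have hS' : (6 : ℚ) * S.card ≤ 5 * n := by exact_mod_cast hS
    have hle' : (geoBroadcastDominationNumber P : ℚ) ≤ S.card := by exact_mod_cast hle
    linarith
  · have hzero : geoBroadcastDominationNumber P = 0 := by
      refine Nat.sInf_eq_zero.mpr ?_
      rcases P.eq_empty_or_nonempty with rfl | ⟨v, hv⟩
      · exact Or.inl ⟨0, ⟨by simp, by simp, by simp⟩, by simp⟩
      · refine Or.inr (Set.eq_empty_of_forall_notMem ?_)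
        rintro c ⟨f, ⟨_, hbound, hdom⟩, _⟩
        obtain ⟨u, hu, hpos, _⟩ := hdom v hv
        have := hbound u hu
        omega
    rw [hzero]
    push_cast
    positivity
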